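/- For every α ∈ (0,1), liminf_{n→∞} (1/n) · log ( sup { ‖p‖_{[−1,1]} / ‖p‖_{E_n} : p a real polynomial, p not identically zero, deg p ≤ α·n } ) ≥ C(α), where C(α) = ((1+α)·log(1+α) + (1−α)·log(1−α))/2. -/

import Mathlib

open MeasureTheory Polynomial Filter Set

/-- The `n`-grid: `n` equally spaced points in `[-1,1]` including the endpoints. -/
noncomputable def nGrid (n : ℕ) : Set ℝ :=
  {x | ∃ k : ℕ, 1 ≤ k ∧ k ≤ n ∧ x = (2 * (k : ℝ) - n - 1) / ((n : ℝ) - 1)}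

/-- Uniform norm of a real polynomial on the interval `[-1,1]`. -/
noncomputable def normI (p : Polynomial ℝ) : ℝ :=
  sSup ((fun x => |p.eval x|) '' Set.Icc (-1 : ℝ) 1)

/-- Uniform norm of a real polynomial on the `n`-grid. -/
noncomputable def normE (n : ℕ) (p : Polynomial ℝ) : ℝ :=
  sSup ((fun x => |p.eval x|) '' nGrid n)

/-- The constant `C(α)`. -/
noncomputable def Cconst (α : ℝ) : ℝ :=
  ((1 + α) * Real.log (1 + α) + (1 - α) * Real.log (1 - α)) / 2

open scoped Nat

/-- Iterated summation by parts, without boundary terms. -/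
theorem sum_fwdDiff_iter_mul (N m : ℕ) (u a : ℝ → ℝ) (h₀ : ∀ i < m, u i = 0)
    (hN : ∀ i < m, u (N + i) = 0) :
    ∑ x ∈ Finset.range N, (fwdDiff (1 : ℝ))^[m] u x * a x =
      (-1) ^ m * ∑ x ∈ Finset.range N, u (x + m) * (fwdDiff (1 : ℝ))^[m] a x := by
  induction m generalizing u with
  | zero => simp
  | succ m ih =>
    rw [Function.iterate_succ_apply, ih]
    · have key (b : ℝ → ℝ) : ∑ x ∈ Finset.range N, fwdDiff 1 u (x + m) * b x =
          -∑ x ∈ Finset.range N, u (x + (m + 1 : ℕ)) * fwdDiff 1 b x := by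
        rw [← sub_eq_zero, sub_neg_eq_add, ← Finset.sum_add_distrib]
        have h := Finset.sum_range_sub (fun x : ℕ => u (x + m) * b x) N
        rw [hN m (by lia)] at h
        have h₀m := h₀ m (by lia)
        simp only [CharP.cast_eq_zero, zero_add, h₀m, zero_mul, sub_self] at h
        rw [← h]
        refine Finset.sum_congr rfl fun x _ => ?_
        simp only [fwdDiff]
        push_cast
        rw [show (x : ℝ) + 1 + m = x + m + 1 by ring, show (x : ℝ) + (m + 1) = x + m + 1 by ring]
        ring
      rw [key, ← Function.iterate_succ_apply' (fwdDiff (1 : ℝ)) m a, pow_succ]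
      ring
    · intro i hi
      have h := h₀ (i + 1) (by lia)
      push_cast at h
      simp [fwdDiff, h, h₀ i (by lia)]
    · intro i hi
      have h := hN (i + 1) (by lia)
      push_cast at h
      rw [← add_assoc] at h
      simp [fwdDiff, h, hN i (by lia)]

/-- The forward difference of a polynomial, as a polynomial. -/
noncomputable def polyDiff (p : ℝ[X]) : ℝ[X] := taylor 1 p - p

theorem eval_polyDiff_iter (k : ℕ) (p : ℝ[X]) :
    (polyDiff^[k] p).eval = (fwdDiff (1 : ℝ))^[k] p.eval := by
  induction k generalizing p with
  | zero => rfl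
  | succ k ih =>
    rw [Function.iterate_succ_apply, Function.iterate_succ_apply, ih]
    congr 1
    ext x
    simp [polyDiff, fwdDiff, taylor_eval]

theorem natDegree_polyDiff_le (p : ℝ[X]) : (polyDiff p).natDegree ≤ p.natDegree - 1 := by
  by_cases hp : p.natDegree = 0
  · rw [eq_C_of_natDegree_eq_zero hp]
    simp [polyDiff]
  · have hp0 : p ≠ 0 := by rintro rfl; simp at hp
    have h : (taylor 1 p - p).degree < p.degree :=
      degree_sub_lt_right (degree_taylor p 1) hp0 (leadingCoeff_taylor 1 p)
    by_cases hq : taylor 1 p - p = 0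
    · simp [polyDiff, hq]
    · have := natDegree_lt_natDegree hq h
      simp only [polyDiff]
      lia

theorem natDegree_polyDiff_iter_le (k : ℕ) (p : ℝ[X]) :
    (polyDiff^[k] p).natDegree ≤ p.natDegree - k := by
  induction k with
  | zero => simp
  | succ k ih =>
    rw [Function.iterate_succ_apply']
    have := natDegree_polyDiff_le (polyDiff^[k] p)
    lia

/-- The monic polynomial `X (X - 1) ⋯ (X - m + 1) (X - N) ⋯ (X - N - m + 1)`. -/
noncomputable def rodriguesPoly (N m : ℕ) : ℝ[X] :=
  (∏ j ∈ Finset.range m, (X - C (j : ℝ))) * ∏ j ∈ Finset.range m, (X - C ((N : ℝ) + j))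

theorem monic_rodriguesPoly (N m : ℕ) : (rodriguesPoly N m).Monic :=
  (monic_prod_X_sub_C _ _).mul (monic_prod_X_sub_C _ _)

theorem natDegree_rodriguesPoly (N m : ℕ) : (rodriguesPoly N m).natDegree = 2 * m := by
  rw [rodriguesPoly, (monic_prod_X_sub_C _ _).natDegree_mul (monic_prod_X_sub_C _ _)]
  rw [natDegree_finsetProd_X_sub_C_eq_card, natDegree_finsetProd_X_sub_C_eq_card]
  simp [two_mul]

theorem eval_rodriguesPoly (N m : ℕ) (x : ℝ) : (rodriguesPoly N m).eval x =
    (∏ j ∈ Finset.range m, (x - j)) * ∏ j ∈ Finset.range m, (x - (N + j)) := by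
  simp [rodriguesPoly, eval_prod]

/-- The discrete Chebyshev (Gram) polynomial of degree `m` on `{0, …, N - 1}`, unnormalised, in its
Rodrigues form. -/
noncomputable def gramPoly (N m : ℕ) : ℝ[X] := polyDiff^[m] (rodriguesPoly N m)

theorem natDegree_gramPoly_le (N m : ℕ) : (gramPoly N m).natDegree ≤ m := by
  have := natDegree_polyDiff_iter_le m (rodriguesPoly N m)
  rw [natDegree_rodriguesPoly] at this
  exact this.trans (by lia)

theorem sum_sq_gramPoly (N m : ℕ) :
    ∑ x ∈ Finset.range N, ((gramPoly N m).eval (x : ℝ)) ^ 2 =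
      ∑ x ∈ Finset.range N, (-1) ^ m * (rodriguesPoly N m).eval ((x : ℝ) + m) * (2 * m)! := by
  have hconst : (fwdDiff (1 : ℝ))^[m] (gramPoly N m).eval = fun _ => ((2 * m)! : ℝ) := by
    have h := (rodriguesPoly N m).fwdDiff_iter_degree_eq_factorial
    rw [natDegree_rodriguesPoly, (monic_rodriguesPoly N m).leadingCoeff, two_mul,
      Function.iterate_add_apply, ← eval_polyDiff_iter m (rodriguesPoly N m)] at h
    rw [gramPoly, h]
    ext x
    simp [two_mul]
  have h := sum_fwdDiff_iter_mul N m (rodriguesPoly N m).eval (gramPoly N m).eval ?_ ?_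
  · rw [hconst, ← eval_polyDiff_iter] at h
    simp only [sq, mul_assoc, ← Finset.mul_sum]
    simpa only [gramPoly] using h
  · intro i hi
    rw [eval_rodriguesPoly, Finset.prod_eq_zero (Finset.mem_range.2 hi) (sub_self _), zero_mul]
  · intro i hi
    rw [eval_rodriguesPoly, mul_comm, Finset.prod_eq_zero (Finset.mem_range.2 hi) (sub_self _),
      zero_mul]

theorem prod_range_natCast_sub (k m : ℕ) :
    ∏ j ∈ Finset.range m, ((k : ℝ) - j) = k.descFactorial m := by
  rw [← descPochhammer_eval_eq_descFactorial, descPochhammer_eval_eq_prod_range]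

theorem choose_mul_choose_le (a b c d : ℕ) :
    a.choose c * b.choose d ≤ (a + b).choose (c + d) := by
  rw [Nat.add_choose_eq]
  exact Finset.single_le_sum (f := fun ij : ℕ × ℕ => a.choose ij.1 * b.choose ij.2)
    (fun _ _ => Nat.zero_le _) (a := (c, d)) (by simp)

theorem eval_rodriguesPoly_shift_le {M m x : ℕ} (hm : m ≤ M) (hx : x ≤ M) :
    (-1) ^ m * (rodriguesPoly (M + 1) m).eval ((x : ℝ) + m) * (2 * m)! ≤
      (m ! : ℝ) ^ 2 * (M + m)! / (M - m)! := by
  have h₁ : ∏ j ∈ Finset.range m, ((x : ℝ) + m - j) = m ! * (x + m).choose m := by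
    have := prod_range_natCast_sub (x + m) m
    push_cast [Nat.descFactorial_eq_factorial_mul_choose] at this
    exact this
  have h₂ : (-1) ^ m * ∏ j ∈ Finset.range m, ((x : ℝ) + m - ((M + 1 : ℕ) + j)) =
      m ! * (M - x).choose m := by
    have := prod_range_natCast_sub (M - x) m
    rw [Nat.descFactorial_eq_factorial_mul_choose, Nat.cast_sub hx] at this
    push_cast at this
    rw [← this, ← Finset.prod_range_reflect, ← Finset.card_range m, ← Finset.prod_const,
      Finset.card_range, ← Finset.prod_mul_distrib]
    refine Finset.prod_congr rfl fun j hj => ?_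
    have hj := Finset.mem_range.1 hj
    rw [Nat.cast_sub (by lia), Nat.cast_sub (by lia)]
    push_cast
    ring
  have h₃ : (x + m).choose m * (M - x).choose m * (2 * m)! * (M - m)! ≤ (M + m)! := by
    have h := choose_mul_choose_le (x + m) (M - x) m m
    rw [show x + m + (M - x) = M + m by lia, ← two_mul] at h
    have h' := Nat.choose_mul_factorial_mul_factorial (show 2 * m ≤ M + m by lia)
    rw [show M + m - 2 * m = M - m by lia] at h'
    rw [← h']
    gcongr
  rw [le_div_iff₀ (by positivity), eval_rodriguesPoly, mul_left_comm, h₁, h₂]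
  have h₄ : (((x + m).choose m : ℝ) * (M - x).choose m * (2 * m)! * (M - m)!) ≤ (M + m)! := by
    exact_mod_cast h₃
  calc _ = (m ! : ℝ) ^ 2 * (((x + m).choose m : ℝ) * (M - x).choose m * (2 * m)! * (M - m)!) := by
        ring
    _ ≤ _ := by gcongr

theorem sq_eval_gramPoly_le {M m x : ℕ} (hm : m ≤ M) (hx : x ≤ M) :
    ((gramPoly (M + 1) m).eval (x : ℝ)) ^ 2 ≤
      (M + 1) * ((m ! : ℝ) ^ 2 * (M + m)! / (M - m)!) := by
  calc ((gramPoly (M + 1) m).eval (x : ℝ)) ^ 2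
      ≤ ∑ x ∈ Finset.range (M + 1), ((gramPoly (M + 1) m).eval (x : ℝ)) ^ 2 :=
        Finset.single_le_sum (f := fun x : ℕ => ((gramPoly (M + 1) m).eval (x : ℝ)) ^ 2)
          (fun _ _ => sq_nonneg _) (Finset.mem_range.2 (by lia))
    _ ≤ ∑ x ∈ Finset.range (M + 1), (m ! : ℝ) ^ 2 * (M + m)! / (M - m)! := by
        rw [sum_sq_gramPoly]
        exact Finset.sum_le_sum fun x hx =>
          eval_rodriguesPoly_shift_le hm (by have := Finset.mem_range.1 hx; lia)
    _ = _ := by simp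

theorem neg_one_pow_mul_prod_half_nonneg {k m : ℕ} (hk : k ≤ m) :
    0 ≤ (-1 : ℝ) ^ (m - k) * ∏ j ∈ Finset.range m, (-1 / 2 + k - j : ℝ) := by
  induction m, hk using Nat.le_induction with
  | base =>
    rw [Nat.sub_self, pow_zero, one_mul]
    refine Finset.prod_nonneg fun j hj => ?_
    have : (j : ℝ) + 1 ≤ k := by exact_mod_cast Finset.mem_range.1 hj
    linarith
  | succ m hk ih =>
    rw [Finset.prod_range_succ, show m + 1 - k = m - k + 1 by lia, pow_succ]
    have : (k : ℝ) ≤ m := by exact_mod_cast hk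
    calc (0 : ℝ) ≤ ((-1 : ℝ) ^ (m - k) * ∏ j ∈ Finset.range m, (-1 / 2 + k - j : ℝ)) *
          (m - k + 1 / 2) := mul_nonneg ih (by linarith)
      _ = _ := by ring

theorem factorial_div_le_prod_half (m : ℕ) :
    (m ! : ℝ) / (2 * m + 1) ≤ ∏ j ∈ Finset.range m, (1 / 2 + j : ℝ) := by
  induction m with
  | zero => simp
  | succ m ih =>
    rw [Finset.prod_range_succ, Nat.factorial_succ]
    calc _ ≤ (m ! : ℝ) / (2 * m + 1) * (1 / 2 + m) := by
          rw [div_mul_eq_mul_div, div_le_div_iff₀ (by positivity) (by positivity)]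
          push_cast
          have : (0 : ℝ) ≤ m ! := by positivity
          nlinarith
      _ ≤ _ := by gcongr

theorem factorial_div_factorial_le_prod (M m : ℕ) :
    ((M + m)! : ℝ) / M ! ≤ ∏ j ∈ Finset.range m, ((M : ℝ) + 3 / 2 + j) := by
  induction m with
  | zero => simp [div_self, Nat.factorial_ne_zero]
  | succ m ih =>
    rw [Finset.prod_range_succ, ← add_assoc, Nat.factorial_succ]
    calc _ = ((M + m)! : ℝ) / M ! * (M + m + 1) := by push_cast; ring
      _ ≤ _ := by gcongr ?_ * ?_; linarith

theorem le_abs_eval_gramPoly {M m : ℕ} (hm : m ≤ M) :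
    (m ! : ℝ) / (2 * m + 1) * ((M + m)! / M !) ≤ |(gramPoly (M + 1) m).eval (-1 / 2)| := by
  have hterm (k : ℕ) (hk : k ≤ m) : 0 ≤ (-1 : ℝ) ^ m * ((-1) ^ (m - k) * (m.choose k : ℝ) *
      (rodriguesPoly (M + 1) m).eval (-1 / 2 + k : ℝ)) := by
    have h₂ : 0 ≤ (-1 : ℝ) ^ m *
        ∏ j ∈ Finset.range m, ((-1 / 2 + k : ℝ) - ((M + 1 : ℕ) + j)) := by
      rw [← Finset.card_range m, ← Finset.prod_const, Finset.card_range,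
        ← Finset.prod_mul_distrib]
      refine Finset.prod_nonneg fun j _ => ?_
      have : (k : ℝ) ≤ M := by exact_mod_cast hk.trans hm
      have : (0 : ℝ) ≤ j := by positivity
      push_cast
      linarith
    rw [eval_rodriguesPoly]
    calc (0 : ℝ) ≤ m.choose k * (((-1 : ℝ) ^ (m - k) *
          ∏ j ∈ Finset.range m, (-1 / 2 + k - j : ℝ)) * ((-1 : ℝ) ^ m *
          ∏ j ∈ Finset.range m, ((-1 / 2 + k : ℝ) - ((M + 1 : ℕ) + j)))) :=
        mul_nonneg (by positivity) (mul_nonneg (neg_one_pow_mul_prod_half_nonneg hk) h₂)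
      _ = _ := by ring
  have heval : (-1 : ℝ) ^ m * (gramPoly (M + 1) m).eval (-1 / 2) =
      ∑ k ∈ Finset.range (m + 1), (-1 : ℝ) ^ m * ((-1) ^ (m - k) * (m.choose k : ℝ) *
        (rodriguesPoly (M + 1) m).eval (-1 / 2 + k : ℝ)) := by
    have h := congrFun (eval_polyDiff_iter m (rodriguesPoly (M + 1) m)) (-1 / 2)
    rw [gramPoly, h, fwdDiff_iter_eq_sum_shift, Finset.mul_sum]
    simp
  have habs : |(gramPoly (M + 1) m).eval (-1 / 2)| =
      |(-1 : ℝ) ^ m * (gramPoly (M + 1) m).eval (-1 / 2)| := by simp [abs_mul]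
  rw [habs, heval]
  refine le_trans ?_ (le_abs_self _)
  refine le_trans ?_ (Finset.single_le_sum (fun k hk => hterm k
    (by have := Finset.mem_range.1 hk; lia)) (Finset.mem_range.2 (Nat.succ_pos m)))
  rw [eval_rodriguesPoly]
  have e₁ : (-1 : ℝ) ^ m * ∏ j ∈ Finset.range m, ((-1 / 2 + (0 : ℕ) : ℝ) - j) =
      ∏ j ∈ Finset.range m, (1 / 2 + j : ℝ) := by
    rw [← Finset.card_range m, ← Finset.prod_const, Finset.card_range, ← Finset.prod_mul_distrib]
    refine Finset.prod_congr rfl fun j _ => ?_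
    push_cast
    ring
  have e₂ : (-1 : ℝ) ^ m * ∏ j ∈ Finset.range m, ((-1 / 2 + (0 : ℕ) : ℝ) - ((M + 1 : ℕ) + j)) =
      ∏ j ∈ Finset.range m, ((M : ℝ) + 3 / 2 + j) := by
    rw [← Finset.card_range m, ← Finset.prod_const, Finset.card_range, ← Finset.prod_mul_distrib]
    refine Finset.prod_congr rfl fun j _ => ?_
    push_cast
    ring
  calc _ ≤ (∏ j ∈ Finset.range m, (1 / 2 + j : ℝ)) *
        ∏ j ∈ Finset.range m, ((M : ℝ) + 3 / 2 + j) :=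
      mul_le_mul (factorial_div_le_prod_half m) (factorial_div_factorial_le_prod M m)
        (by positivity) (by positivity)
    _ = _ := by
      rw [← e₁, ← e₂, Nat.choose_zero_right, Nat.sub_zero]
      push_cast
      ring

theorem abs_eval_le_normI (p : ℝ[X]) {x : ℝ} (hx : x ∈ Icc (-1 : ℝ) 1) : |p.eval x| ≤ normI p :=
  le_csSup (isCompact_Icc.bddAbove_image p.continuous.abs.continuousOn) (mem_image_of_mem _ hx)

theorem normI_le {p : ℝ[X]} {B : ℝ} (h : ∀ x ∈ Icc (-1 : ℝ) 1, |p.eval x| ≤ B) : normI p ≤ B :=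
  csSup_le ((nonempty_Icc.2 (by norm_num)).image _) (forall_mem_image.2 h)

theorem normI_nonneg (p : ℝ[X]) : 0 ≤ normI p :=
  (abs_nonneg _).trans (abs_eval_le_normI p (x := 0) (by simp))

theorem normI_pos {p : ℝ[X]} (hp : p ≠ 0) : 0 < normI p := by
  refine (normI_nonneg p).lt_of_ne' fun h => hp ?_
  refine eq_zero_of_infinite_isRoot p ((Icc_infinite (show (-1 : ℝ) < 1 by norm_num)).mono ?_)
  intro x hx
  exact abs_nonpos_iff.1 (h ▸ abs_eval_le_normI p hx)

theorem mem_nGrid_succ {m : ℕ} (hm : m ≠ 0) {x : ℝ} :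
    x ∈ nGrid (m + 1) ↔ ∃ k ≤ m, x = 2 / m * k - 1 := by
  have hm' : (m : ℝ) ≠ 0 := by exact_mod_cast hm
  constructor
  · rintro ⟨k, hk, hkm, rfl⟩
    refine ⟨k - 1, by lia, ?_⟩
    rw [Nat.cast_sub hk]
    push_cast
    rw [add_sub_cancel_right]
    field_simp
    ring
  · rintro ⟨k, hkm, rfl⟩
    refine ⟨k + 1, by lia, by lia, ?_⟩
    push_cast
    rw [add_sub_cancel_right]
    field_simp
    ring

theorem nGrid_succ_eq {m : ℕ} (hm : m ≠ 0) :
    nGrid (m + 1) = (fun k : ℕ => (2 / m * k - 1 : ℝ)) '' Iic m := by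
  ext x
  simp [mem_nGrid_succ hm, eq_comm]

theorem abs_eval_le_normE {m : ℕ} (hm : m ≠ 0) (p : ℝ[X]) {k : ℕ} (hk : k ≤ m) :
    |p.eval (2 / m * k - 1 : ℝ)| ≤ normE (m + 1) p := by
  refine le_csSup ?_ (mem_image_of_mem _ ((mem_nGrid_succ hm).2 ⟨k, hk, rfl⟩))
  rw [nGrid_succ_eq hm]
  exact (((finite_Iic m).image _).image _).bddAbove

theorem normE_le {m : ℕ} (hm : m ≠ 0) {p : ℝ[X]} {B : ℝ}
    (h : ∀ k ≤ m, |p.eval (2 / m * (k : ℝ) - 1)| ≤ B) : normE (m + 1) p ≤ B := by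
  rw [normE, nGrid_succ_eq hm]
  refine csSup_le ((nonempty_Iic.image _).image _) ?_
  rintro _ ⟨_, ⟨k, hk, rfl⟩, rfl⟩
  exact h k hk

theorem prod_erase_abs_sub {k m : ℕ} (hk : k ≤ m) :
    ∏ j ∈ (Finset.range (m + 1)).erase k, |(k : ℝ) - j| = k ! * (m - k)! := by
  induction m, hk using Nat.le_induction with
  | base =>
    rw [Finset.range_add_one, Finset.erase_insert (by simp), ← Finset.abs_prod,
      prod_range_natCast_sub, Nat.descFactorial_self]
    simp
  | succ m hk ih =>
    rw [Finset.range_add_one, Finset.erase_insert_of_ne (by lia),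
      Finset.prod_insert (by simp), ih, show m + 1 - k = m - k + 1 by lia, Nat.factorial_succ]
    have : (k : ℝ) ≤ m := by exact_mod_cast hk
    rw [abs_sub_comm, abs_of_nonneg (by push_cast; linarith)]
    push_cast [hk]
    ring

theorem abs_eval_basis_le {k m : ℕ} (hk : k ≤ m) {y : ℝ} (hy : y ∈ Icc (0 : ℝ) m) :
    |(Lagrange.basis (Finset.range (m + 1)) (fun j : ℕ => (j : ℝ)) k).eval y| ≤
      m.choose k * Real.exp 1 ^ m := by
  have h₁ : |(Lagrange.basis (Finset.range (m + 1)) (fun j : ℕ => (j : ℝ)) k).eval y| =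
      (∏ j ∈ (Finset.range (m + 1)).erase k, |y - j|) / (k ! * (m - k)!) := by
    rw [← prod_erase_abs_sub hk, ← Finset.prod_div_distrib, Lagrange.basis, eval_prod,
      Finset.abs_prod]
    refine Finset.prod_congr rfl fun j _ => ?_
    simp [Lagrange.basisDivisor, abs_mul, abs_inv, div_eq_inv_mul]
  have h₂ : ∏ j ∈ (Finset.range (m + 1)).erase k, |y - j| ≤ (m : ℝ) ^ m := by
    have hcard : ((Finset.range (m + 1)).erase k).card = m := by
      rw [Finset.card_erase_of_mem (by simp; lia)]
      simp
    calc _ ≤ ∏ j ∈ (Finset.range (m + 1)).erase k, (m : ℝ) := by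
          refine Finset.prod_le_prod (fun _ _ => abs_nonneg _) fun j hj => ?_
          have : (j : ℝ) ≤ m := by
            have := Finset.mem_range.1 (Finset.mem_of_mem_erase hj)
            exact_mod_cast (by lia : j ≤ m)
          have : (0 : ℝ) ≤ j := by positivity
          exact abs_le.2 ⟨by linarith [hy.1], by linarith [hy.2]⟩
      _ = _ := by rw [Finset.prod_const, hcard]
  have h₃ : (m : ℝ) ^ m / m ! ≤ Real.exp 1 ^ m := by
    rw [← Real.exp_nat_mul, mul_one]
    exact Real.pow_div_factorial_le_exp _ (by positivity) m
  rw [h₁]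
  calc _ ≤ (m : ℝ) ^ m / (k ! * (m - k)!) := by gcongr
    _ = m.choose k * ((m : ℝ) ^ m / m !) := by
      rw [Nat.cast_choose ℝ hk]
      field_simp
    _ ≤ _ := by gcongr

theorem abs_eval_le_of_abs_eval_nat_le {m : ℕ} {q : ℝ[X]} {B : ℝ} (hq : q.natDegree ≤ m)
    (hB : ∀ k : ℕ, k ≤ m → |q.eval (k : ℝ)| ≤ B) {y : ℝ} (hy : y ∈ Icc (0 : ℝ) m) :
    |q.eval y| ≤ (2 * Real.exp 1) ^ m * B := by
  have hdeg : q.degree < (Finset.range (m + 1)).card := by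
    rw [Finset.card_range]
    exact (degree_le_of_natDegree_le hq).trans_lt (by exact_mod_cast Nat.lt_succ_self m)
  have h := Lagrange.eq_interpolate (v := fun j : ℕ => (j : ℝ)) (Nat.cast_injective.injOn) hdeg
  rw [h, Lagrange.interpolate_apply, eval_finsetSum]
  calc _ ≤ ∑ k ∈ Finset.range (m + 1), |(C (q.eval (k : ℝ)) *
          Lagrange.basis (Finset.range (m + 1)) (fun j : ℕ => (j : ℝ)) k).eval y| :=
        Finset.abs_sum_le_sum_abs _ _
    _ ≤ ∑ k ∈ Finset.range (m + 1), B * (m.choose k * Real.exp 1 ^ m) := by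
        refine Finset.sum_le_sum fun k hk => ?_
        have hk : k ≤ m := by have := Finset.mem_range.1 hk; lia
        rw [eval_mul, eval_C, abs_mul]
        exact mul_le_mul (hB k hk) (abs_eval_basis_le hk hy) (abs_nonneg _)
          ((abs_nonneg _).trans (hB k hk))
    _ = _ := by
        have : (∑ k ∈ Finset.range (m + 1), (m.choose k : ℝ)) = 2 ^ m := by
          exact_mod_cast Nat.sum_range_choose m
        rw [← Finset.mul_sum, ← Finset.sum_mul, this]
        ring

theorem normI_le_mul_normE {m : ℕ} (hm : m ≠ 0) {p : ℝ[X]} (hp : p.natDegree ≤ m) :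
    normI p ≤ (2 * Real.exp 1) ^ m * normE (m + 1) p := by
  have hm' : (0 : ℝ) < m := by exact_mod_cast Nat.pos_of_ne_zero hm
  refine normI_le fun x hx => ?_
  have hq : (p.comp (C (2 / m : ℝ) * X - 1)).natDegree ≤ m := by
    refine natDegree_comp_le.trans ?_
    have : (C (2 / m : ℝ) * X - 1).natDegree ≤ 1 := by compute_degree
    nlinarith
  have h := abs_eval_le_of_abs_eval_nat_le (B := normE (m + 1) p) hq ?_
    (y := m / 2 * (x + 1)) ⟨?_, ?_⟩
  · have hx' : (2 / m * (m / 2 * (x + 1)) - 1 : ℝ) = x := by field_simp; ring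
    simpa [eval_comp, hx'] using h
  · intro k hk
    simpa [eval_comp] using abs_eval_le_normE hm p hk
  · have := hx.1
    exact mul_nonneg (by positivity) (by linarith)
  · have := hx.2
    calc (m / 2 * (x + 1) : ℝ) ≤ m / 2 * 2 := by gcongr; linarith
      _ = m := by ring

theorem exists_le_ratio {M m : ℕ} (hm : m ≤ M) :
    ∃ p : ℝ[X], p ≠ 0 ∧ p.natDegree ≤ m + 1 ∧
      1 / 2 * ((m ! : ℝ) / (2 * m + 1) * ((M + m)! / M !)) /
        √((M + 1) ^ 3 * ((m ! : ℝ) ^ 2 * (M + m)! / (M - m)!)) ≤ normI p / normE (M + 2) p := by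
  set L : ℝ := 1 / 2 * ((m ! : ℝ) / (2 * m + 1) * ((M + m)! / M !)) with hL
  have hLpos : 0 < L := by positivity
  set q : ℝ[X] := X * (gramPoly (M + 1) m).comp (X - 1) with hq
  set l : ℝ[X] := C ((M + 1 : ℝ) / 2) * (X + 1) with hl
  have heval (y : ℝ) : (q.comp l).eval (2 / (M + 1 : ℕ) * y - 1) =
      y * (gramPoly (M + 1) m).eval (y - 1) := by
    have : ((M : ℝ) + 1) / 2 * (2 / (M + 1) * y) = y := by field_simp
    simp [hq, hl, eval_comp, this]
  have hlow : L ≤ normI (q.comp l) := by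
    refine le_trans ?_ (abs_eval_le_normI (q.comp l)
      (x := 2 / (M + 1 : ℕ) * (1 / 2) - 1) ⟨?_, ?_⟩)
    · rw [heval, abs_mul, abs_of_pos (by norm_num : (0 : ℝ) < 1 / 2),
        show (1 / 2 - 1 : ℝ) = -1 / 2 by norm_num]
      have := le_abs_eval_gramPoly hm
      rw [hL]
      gcongr
    · have : (0 : ℝ) ≤ 2 / (M + 1 : ℕ) * (1 / 2) := by positivity
      linarith
    · have : (2 / (M + 1 : ℕ) * (1 / 2) : ℝ) ≤ 1 := by
        push_cast
        rw [div_mul_eq_mul_div, div_le_one (by positivity)]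
        have : (0 : ℝ) ≤ M := by positivity
        linarith
      linarith
  have hne : q.comp l ≠ 0 := by
    intro h
    rw [h] at hlow
    have : normI (0 : ℝ[X]) ≤ 0 := normI_le (by simp)
    linarith
  have hdeg : (q.comp l).natDegree ≤ m + 1 := by
    have hl1 : l.natDegree ≤ 1 := by rw [hl]; compute_degree
    have hX : (X - 1 : ℝ[X]).natDegree ≤ 1 := by compute_degree
    have h₁ : ((gramPoly (M + 1) m).comp (X - 1)).natDegree ≤ m :=
      natDegree_comp_le.trans ((Nat.mul_le_mul (natDegree_gramPoly_le _ _) hX).trans (by simp))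
    have h₂ : q.natDegree ≤ m + 1 := by
      refine natDegree_mul_le.trans ?_
      rw [natDegree_X]
      lia
    exact natDegree_comp_le.trans ((Nat.mul_le_mul h₂ hl1).trans (by simp))
  have hup : normE (M + 1 + 1) (q.comp l) ≤
      √((M + 1) ^ 3 * ((m ! : ℝ) ^ 2 * (M + m)! / (M - m)!)) := by
    refine normE_le M.add_one_ne_zero fun k hk => Real.abs_le_sqrt ?_
    rw [heval]
    rcases k with _ | k
    · rw [Nat.cast_zero, zero_mul, zero_pow two_ne_zero]
      positivity
    · have h := sq_eval_gramPoly_le hm (x := k) (by lia)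
      have hk' : ((k + 1 : ℕ) : ℝ) ≤ M + 1 := by exact_mod_cast hk
      rw [mul_pow, show ((k + 1 : ℕ) : ℝ) - 1 = k by push_cast; ring]
      calc _ ≤ ((M : ℝ) + 1) ^ 2 * ((M + 1) * ((m ! : ℝ) ^ 2 * (M + m)! / (M - m)!)) := by gcongr
        _ = _ := by ring
  refine ⟨q.comp l, hne, hdeg, ?_⟩
  have hpos : 0 < normE (M + 1 + 1) (q.comp l) := by
    by_contra! h
    have h₁ := normI_le_mul_normE M.add_one_ne_zero (hdeg.trans (by lia : m + 1 ≤ M + 1))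
    have h₂ : (2 * Real.exp 1) ^ (M + 1) * normE (M + 1 + 1) (q.comp l) ≤ 0 :=
      mul_nonpos_of_nonneg_of_nonpos (by positivity) h
    linarith [normI_pos hne]
  exact div_le_div₀ (normI_nonneg _) hlow hpos hup

theorem mul_log_sub_le_log_factorial (n : ℕ) : n * Real.log n - n ≤ Real.log n ! := by
  rcases n.eq_zero_or_pos with rfl | hn
  · simp
  have hn' : (0 : ℝ) < n := by exact_mod_cast hn
  have h := Real.log_le_log (by positivity) (Real.pow_div_factorial_le_exp (n : ℝ) hn'.le n)
  rw [Real.log_exp, Real.log_div (by positivity) (by positivity), Real.log_pow] at h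
  linarith

theorem log_factorial_le {n : ℕ} (hn : 1 ≤ n) :
    Real.log n ! ≤ n * Real.log n - n + 1 + Real.log n := by
  induction n, hn using Nat.le_induction with
  | base => simp
  | succ n hn ih =>
    have hn' : (0 : ℝ) < n := by exact_mod_cast hn
    have h := Real.log_le_sub_one_of_pos (show (0 : ℝ) < n / (n + 1) by positivity)
    rw [Real.log_div (by positivity) (by positivity)] at h
    have h' : (1 : ℝ) ≤ (n + 1) * (Real.log (n + 1) - Real.log n) := by
      have h₂ : (n / (n + 1) - 1 : ℝ) = -(1 / (n + 1)) := by field_simp; ring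
      have h₃ : 1 / ((n : ℝ) + 1) ≤ Real.log (n + 1) - Real.log n := by linarith
      rwa [div_le_iff₀' (by positivity)] at h₃
    rw [Nat.factorial_succ]
    push_cast
    rw [Real.log_mul (by positivity) (by positivity)]
    linarith

theorem mul_Cconst_sub_le {M m : ℕ} (hm : m < M) :
    M * Cconst (m / M) - 10 * Real.log (2 * M + 1) - 3 ≤
      Real.log (1 / 2 * ((m ! : ℝ) / (2 * m + 1) * ((M + m)! / M !)) /
        √((M + 1) ^ 3 * ((m ! : ℝ) ^ 2 * (M + m)! / (M - m)!))) := by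
  have hM : (0 : ℝ) < M := by exact_mod_cast (by lia : 0 < M)
  have hmM : (m : ℝ) < M := by exact_mod_cast hm
  have hm0 : (0 : ℝ) ≤ m := by positivity
  have e₁ : Real.log (M + m) = Real.log M + Real.log (1 + m / M) := by
    have : (0 : ℝ) < 1 + m / M := by positivity
    rw [← Real.log_mul (by positivity) (by positivity)]
    congr 1
    field_simp
  have e₂ : Real.log (M - m) = Real.log M + Real.log (1 - m / M) := by
    have : (0 : ℝ) < 1 - m / M := by rw [sub_pos, div_lt_one hM]; exact hmM
    rw [← Real.log_mul (by positivity) (by positivity)]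
    congr 1
    field_simp
  have f₁ := mul_log_sub_le_log_factorial (M + m)
  have f₂ := mul_log_sub_le_log_factorial (M - m)
  have f₃ := log_factorial_le (show 1 ≤ M by lia)
  have hC : M * Cconst (m / M) = ((M + m) * Real.log (1 + m / M) +
      (M - m) * Real.log (1 - m / M)) / 2 := by
    rw [Cconst]
    field_simp
  rw [Nat.cast_sub hm.le, e₂] at f₂
  push_cast at f₁
  rw [e₁] at f₁
  have g₁ : Real.log (2 * m + 1) ≤ Real.log (2 * M + 1) :=
    Real.log_le_log (by positivity) (by linarith)
  have g₂ : Real.log (M + 1) ≤ Real.log (2 * M + 1) :=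
    Real.log_le_log (by positivity) (by linarith)
  have g₃ : Real.log M ≤ Real.log (2 * M + 1) := Real.log_le_log (by positivity) (by linarith)
  have g₄ : 0 ≤ Real.log (2 * M + 1) := Real.log_nonneg (by linarith)
  have g₅ : Real.log 2 ≤ 1 := by linarith [Real.log_two_lt_d9]
  rw [Real.log_div (by positivity) (by positivity), Real.log_sqrt (by positivity),
    Real.log_mul (by positivity) (by positivity), Real.log_mul (by positivity) (by positivity),
    Real.log_div one_ne_zero two_ne_zero, Real.log_one, Real.log_div (by positivity) (by positivity),
    Real.log_div (by positivity) (by positivity), Real.log_mul (by positivity) (by positivity),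
    Real.log_div (by positivity) (by positivity), Real.log_mul (by positivity) (by positivity),
    Real.log_pow, Real.log_pow, hC]
  push_cast
  linarith

theorem extremal_ratio_liminf (α : ℝ) (hα : α ∈ Set.Ioo (0 : ℝ) 1) :
    Cconst α ≤ Filter.liminf (fun n : ℕ =>
        (n : ℝ)⁻¹ * Real.log (sSup {t : ℝ | ∃ p : Polynomial ℝ, p ≠ 0 ∧
          (p.natDegree : ℝ) ≤ α * n ∧ t = normI p / normE n p})) atTop := by
  obtain ⟨hα0, hα1⟩ := hα
  set S : ℕ → Set ℝ := fun n => {t : ℝ | ∃ p : Polynomial ℝ, p ≠ 0 ∧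
    (p.natDegree : ℝ) ≤ α * n ∧ t = normI p / normE n p} with hS
  change Cconst α ≤ Filter.liminf (fun n : ℕ => (n : ℝ)⁻¹ * Real.log (sSup (S n))) atTop
  have hupper : ∀ n ≥ 2, ∀ t ∈ S n, t ≤ (2 * Real.exp 1) ^ n := by
    rintro n hn _ ⟨p, -, hp, rfl⟩
    obtain ⟨m, rfl⟩ : ∃ m, n = m + 1 := ⟨n - 1, by lia⟩
    have hm : m ≠ 0 := by lia
    have hdeg : p.natDegree ≤ m := by
      have h : (p.natDegree : ℝ) < (m + 1 : ℕ) :=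
        hp.trans_lt (mul_lt_of_lt_one_left (by positivity) hα1)
      have : p.natDegree < m + 1 := by exact_mod_cast h
      lia
    have hE : 0 ≤ normE (m + 1) p := (abs_nonneg _).trans (abs_eval_le_normE hm p (Nat.zero_le m))
    have he : 1 ≤ 2 * Real.exp 1 := by linarith [Real.add_one_le_exp 1]
    exact (div_le_of_le_mul₀ hE (by positivity) (normI_le_mul_normE hm hdeg)).trans
      (pow_le_pow_right₀ he (by lia))
  set m : ℕ → ℕ := fun n => ⌊α * n⌋₊ - 1 with hmdef
  set v : ℕ → ℝ := fun n => (n : ℝ)⁻¹ * (((n - 2 : ℕ) : ℝ) * Cconst (m n / (n - 2 : ℕ)) -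
    10 * Real.log (2 * (n - 2 : ℕ) + 1) - 3) with hv
  have hlarge : ∀ᶠ n : ℕ in atTop, 2 ≤ n ∧ 1 ≤ α * n ∧ 1 < (1 - α) * n := by
    have h₁ := tendsto_natCast_atTop_atTop (R := ℝ).const_mul_atTop hα0
    have h₂ := tendsto_natCast_atTop_atTop (R := ℝ).const_mul_atTop (sub_pos.2 hα1)
    filter_upwards [eventually_ge_atTop 2, h₁.eventually_ge_atTop 1, h₂.eventually_gt_atTop 1]
      with n a b c using ⟨a, b, c⟩
  have hlower : ∀ᶠ n : ℕ in atTop, 1 < n ∧ 0 < sSup (S n) ∧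
      v n ≤ (n : ℝ)⁻¹ * Real.log (sSup (S n)) := by
    filter_upwards [hlarge] with n ⟨hn, h₁, h₂⟩
    obtain ⟨M, rfl⟩ : ∃ M, n = M + 2 := ⟨n - 2, by lia⟩
    have hfl : 1 ≤ ⌊α * (M + 2 : ℕ)⌋₊ := Nat.one_le_floor_iff _ |>.2 h₁
    have hfl' : (⌊α * (M + 2 : ℕ)⌋₊ : ℝ) ≤ α * (M + 2 : ℕ) := Nat.floor_le (by positivity)
    have hmM : m (M + 2) < M := by
      have : (⌊α * (M + 2 : ℕ)⌋₊ : ℝ) < (M + 1 : ℕ) := by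
        push_cast at h₂ hfl' ⊢
        linarith
      have : ⌊α * (M + 2 : ℕ)⌋₊ < M + 1 := by exact_mod_cast this
      simp only [hmdef]
      lia
    obtain ⟨p, hp, hdeg, hratio⟩ := exists_le_ratio hmM.le
    have hmem : normI p / normE (M + 2) p ∈ S (M + 2) := by
      refine ⟨p, hp, le_trans ?_ hfl', rfl⟩
      simp only [hmdef] at hdeg
      exact_mod_cast (by lia : p.natDegree ≤ ⌊α * (M + 2 : ℕ)⌋₊)
    have hsup := hratio.trans (le_csSup ⟨_, hupper (M + 2) hn⟩ hmem)
    refine ⟨hn, lt_of_lt_of_le (by positivity) hsup, ?_⟩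
    simp only [hv, Nat.add_sub_cancel]
    refine mul_le_mul_of_nonneg_left ?_ (by positivity)
    exact (mul_Cconst_sub_le hmM).trans (Real.log_le_log (by positivity) hsup)
  have hinv : Tendsto (fun n : ℕ => (n : ℝ)⁻¹) atTop (nhds 0) :=
    tendsto_inv_atTop_nhds_zero_nat
  have hM : Tendsto (fun n : ℕ => (n : ℝ)⁻¹ * (n - 2 : ℕ)) atTop (nhds 1) := by
    have h : Tendsto (fun n : ℕ => 1 - 2 * (n : ℝ)⁻¹) atTop (nhds (1 - 2 * 0)) :=
      tendsto_const_nhds.sub (hinv.const_mul 2)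
    rw [mul_zero, sub_zero] at h
    refine h.congr' ?_
    filter_upwards [eventually_ge_atTop 2] with n hn
    have : (n : ℝ) ≠ 0 := by exact_mod_cast (by lia : n ≠ 0)
    rw [Nat.cast_sub hn]
    push_cast
    field_simp
  have hm : Tendsto (fun n : ℕ => (n : ℝ)⁻¹ * m n) atTop (nhds α) := by
    have h := ((tendsto_nat_floor_mul_div_atTop hα0.le).comp
      (tendsto_natCast_atTop_atTop (R := ℝ))).sub hinv
    rw [sub_zero] at h
    refine h.congr' ?_
    filter_upwards [hlarge] with n ⟨hn, h₁, h₂⟩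
    simp only [hmdef, Function.comp_apply]
    rw [Nat.cast_sub (Nat.one_le_floor_iff _ |>.2 h₁)]
    push_cast
    ring
  have hratio : Tendsto (fun n : ℕ => (m n : ℝ) / (n - 2 : ℕ)) atTop (nhds α) := by
    have h := hm.div hM one_ne_zero
    rw [div_one] at h
    refine h.congr' ?_
    filter_upwards [eventually_ge_atTop 2] with n hn
    have : (n : ℝ) ≠ 0 := by exact_mod_cast (by lia : n ≠ 0)
    exact mul_div_mul_left _ _ (inv_ne_zero this)
  have hC : ContinuousAt Cconst α := by
    have h₁ : 1 + α ≠ 0 := by linarith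
    have h₂ : 1 - α ≠ 0 := by linarith
    unfold Cconst
    fun_prop (disch := assumption)
  have hlog : Tendsto (fun n : ℕ => (n : ℝ)⁻¹ * Real.log (2 * (n - 2 : ℕ) + 1)) atTop
      (nhds 0) := by
    have h₁ : Tendsto (fun n : ℕ => (n : ℝ)⁻¹ * Real.log (2 * n)) atTop (nhds 0) := by
      have h := (Real.isLittleO_log_id_atTop.tendsto_div_nhds_zero.comp
        (tendsto_natCast_atTop_atTop (R := ℝ))).add (hinv.const_mul (Real.log 2))
      rw [mul_zero, add_zero] at h
      refine h.congr' ?_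
      filter_upwards [eventually_ge_atTop 1] with n hn
      have : (n : ℝ) ≠ 0 := by exact_mod_cast (by lia : n ≠ 0)
      rw [Real.log_mul two_ne_zero this]
      simp only [Function.comp_apply, id]
      ring
    refine squeeze_zero' (.of_forall fun n => ?_) ?_ h₁
    · have : (0 : ℝ) ≤ (n - 2 : ℕ) := by positivity
      exact mul_nonneg (by positivity) (Real.log_nonneg (by linarith))
    · filter_upwards [eventually_ge_atTop 2] with n hn
      refine mul_le_mul_of_nonneg_left (Real.log_le_log (by positivity) ?_) (by positivity)
      rw [Nat.cast_sub hn]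
      push_cast
      linarith
  have hvlim : Tendsto v atTop (nhds (Cconst α)) := by
    have h := ((hM.mul (hC.tendsto.comp hratio)).sub (hlog.const_mul 10)).sub (hinv.const_mul 3)
    simp only [one_mul, mul_zero, sub_zero] at h
    refine h.congr fun n => ?_
    simp only [hv, Function.comp_apply]
    ring
  have hbdd : ∀ᶠ n : ℕ in atTop,
      (n : ℝ)⁻¹ * Real.log (sSup (S n)) ≤ Real.log (2 * Real.exp 1) := by
    filter_upwards [hlower] with n ⟨hn, hpos, _⟩
    have hn' : (0 : ℝ) < n := by exact_mod_cast (by lia : 0 < n)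
    have hsup : sSup (S n) ≤ (2 * Real.exp 1) ^ n :=
      Real.sSup_le (hupper n hn) (by positivity)
    have h := Real.log_le_log hpos hsup
    rw [Real.log_pow] at h
    rwa [inv_mul_le_iff₀ hn']
  rw [← hvlim.liminf_eq]
  refine liminf_le_liminf (hlower.mono fun n h => h.2.2) hvlim.isBoundedUnder_ge ?_
  exact (isBoundedUnder_of_eventually_le hbdd).isCoboundedUnder_ge
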